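/- arXiv:2404.12951 — 2 statements merged into one kernel-verified Lean document; each statement's English description precedes it below -/
import Mathlib

section
/- (Diamond and confluence of administrative reduction.) In the distant Bang calculus λ!, the reduction →F,d! satisfies the diamond property: if t →F,d! u₁, t →F,d! u₂ and u₁ ≠ u₂, then there exists s with u₁ →F,d! s and u₂ →F,d! s. Consequently →F,d! is confluent: if t →F,d!* u₁ and t →F,d!* u₂ then there exists s with u₁ →F,d!* s and u₂ →F,d!* s. -/
namespace BangPaper

/-! ### Generic rewriting notions -/

/-- `a` is a normal form for the relation `r`. -/
def IsNF {α : Type*} (r : α → α → Prop) (a : α) : Prop := ∀ b, ¬ r a b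

/-- Reflexive-transitive closure of the union of two relations,
counting the number of steps of each. -/
inductive Counted2 {α : Type*} (r₁ r₂ : α → α → Prop) : ℕ → ℕ → α → α → Prop
  | refl (t : α) : Counted2 r₁ r₂ 0 0 t t
  | step₁ {t u v : α} {m n : ℕ} :
      r₁ t u → Counted2 r₁ r₂ m n u v → Counted2 r₁ r₂ (m + 1) n t v
  | step₂ {t u v : α} {m n : ℕ} :
      r₂ t u → Counted2 r₁ r₂ m n u v → Counted2 r₁ r₂ m (n + 1) t v

/-- Reflexive-transitive closure of the union of three relations,
counting the number of steps of each. -/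
inductive Counted3 {α : Type*} (r₁ r₂ r₃ : α → α → Prop) : ℕ → ℕ → ℕ → α → α → Prop
  | refl (t : α) : Counted3 r₁ r₂ r₃ 0 0 0 t t
  | step₁ {t u v : α} {m n k : ℕ} :
      r₁ t u → Counted3 r₁ r₂ r₃ m n k u v → Counted3 r₁ r₂ r₃ (m + 1) n k t v
  | step₂ {t u v : α} {m n k : ℕ} :
      r₂ t u → Counted3 r₁ r₂ r₃ m n k u v → Counted3 r₁ r₂ r₃ m (n + 1) k t v
  | step₃ {t u v : α} {m n k : ℕ} :
      r₃ t u → Counted3 r₁ r₂ r₃ m n k u v → Counted3 r₁ r₂ r₃ m n (k + 1) t v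

/-! ### Terms of the distant Bang calculus λ! (de Bruijn representation) -/

/-- Terms of λ!: variables, application, abstraction, bang, dereliction and
explicit substitution (`sub t u` is `t[x←u]`, the binder being in `t`). -/
inductive T : Type
  | var : ℕ → T
  | app : T → T → T
  | lam : T → T
  | bang : T → T
  | der : T → T
  | sub : T → T → T

namespace T

/-- Lift (shift by one) the free de Bruijn variables `≥ k`. -/
def lift (k : ℕ) : T → T
  | var n => if n < k then var n else var (n + 1)
  | app a b => app (lift k a) (lift k b)
  | lam a => lam (lift (k + 1) a)
  | bang a => bang (lift k a)
  | der a => der (lift k a)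
  | sub a b => sub (lift (k + 1) a) (lift k b)

/-- Lift all free variables by `m` (crossing `m` binders). -/
def liftN (m : ℕ) (t : T) : T := (lift 0)^[m] t

/-- Lift all free variables except the first one by `m`
(used to push a term with one distinguished bound variable under `m` extra binders). -/
def liftUnder (m : ℕ) (t : T) : T := (lift 1)^[m] t

/-- Capture-avoiding substitution `t{k := u}` of `u` for de Bruijn variable `k`. -/
def subst : T → ℕ → T → T
  | var n, k, u => if n < k then var n else if n = k then liftN k u else var (n - 1)
  | app a b, k, u => app (subst a k u) (subst b k u)
  | lam a, k, u => lam (subst a (k + 1) u)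
  | bang a, k, u => bang (subst a k u)
  | der a, k, u => der (subst a k u)
  | sub a b, k, u => sub (subst a (k + 1) u) (subst b k u)

/-- The number of constructors (full size) of a term: it counts all
applications, abstractions, explicit substitutions, `!` and `der` occurrences. -/
def size : T → ℕ
  | var _ => 0
  | app a b => 1 + size a + size b
  | lam a => 1 + size a
  | bang a => 1 + size a
  | der a => 1 + size a
  | sub a b => 1 + size a + size b

end T

/-- Plugging a term into a list context `⟨·⟩[x₁←t₁]…[xₙ←tₙ]`
(represented as the list `[t₁, …, tₙ]`). -/
def fillL : T → List T → T
  | s, [] => s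
  | s, t :: L => fillL (T.sub s t) L

/-! ### Rewrite rules of λ! -/

/-- The names of the three rewrite rules of λ!: `dB`, `s!` and `d!`. -/
inductive Rule : Type
  | dB : Rule
  | sBang : Rule
  | dBang : Rule

/-- Root steps of the three rewrite rules of λ! (at a distance, capture-free):
`(dB)  L⟨λx.t⟩ u ↦ L⟨t[x←u]⟩`, `(s!)  t[x←L⟨!u⟩] ↦ L⟨t{x:=u}⟩`,
`(d!)  der(L⟨!t⟩) ↦ L⟨t⟩`. -/
inductive Root : Rule → T → T → Prop
  | dB (t u : T) (L : List T) :
      Root Rule.dB (T.app (fillL (T.lam t) L) u)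
        (fillL (T.sub t (T.liftN L.length u)) L)
  | sBang (t u : T) (L : List T) :
      Root Rule.sBang (T.sub t (fillL (T.bang u) L))
        (fillL (T.subst (T.liftUnder L.length t) 0 u) L)
  | dBang (t : T) (L : List T) :
      Root Rule.dBang (T.der (fillL (T.bang t) L)) (fillL t L)

/-! ### Contexts of λ! -/

/-- (Full) contexts of λ!: terms with exactly one hole, the hole may occur anywhere. -/
inductive Ctx : Type
  | hole : Ctx
  | appL : Ctx → T → Ctx
  | appR : T → Ctx → Ctx
  | lam : Ctx → Ctx
  | bang : Ctx → Ctx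
  | der : Ctx → Ctx
  | subL : Ctx → T → Ctx
  | subR : T → Ctx → Ctx

namespace Ctx

/-- Plugging a term in a context (possibly capturing its free variables). -/
def fill : Ctx → T → T
  | hole, s => s
  | appL C t, s => T.app (fill C s) t
  | appR t C, s => T.app t (fill C s)
  | lam C, s => T.lam (fill C s)
  | bang C, s => T.bang (fill C s)
  | der C, s => T.der (fill C s)
  | subL C t, s => T.sub (fill C s) t
  | subR t C, s => T.sub t (fill C s)

/-- Surface contexts: the hole does not occur under a `!`. -/
def Surface : Ctx → Prop
  | hole => True
  | appL C _ => Surface C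
  | appR _ C => Surface C
  | lam C => Surface C
  | bang _ => False
  | der C => Surface C
  | subL C _ => Surface C
  | subR _ C => Surface C

/-- Internal contexts: the full contexts that are not surface (the hole occurs under a `!`). -/
def Internal (C : Ctx) : Prop := ¬ Surface C

end Ctx

/-! ### Reductions of λ! -/

/-- `StepAt R C t u`: `t` rewrites to `u` by firing a redex of rule `R` under context `C`. -/
def StepAt (R : Rule) (C : Ctx) (t u : T) : Prop :=
  ∃ a b, Root R a b ∧ t = C.fill a ∧ u = C.fill b

/-- One step of rule `R` under some full context (`→F,R`). -/
def FStepR (R : Rule) (t u : T) : Prop := ∃ C : Ctx, StepAt R C t u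

/-- One step of rule `R` under some surface context (`→S,R`). -/
def SStepR (R : Rule) (t u : T) : Prop := ∃ C : Ctx, C.Surface ∧ StepAt R C t u

/-- One step of rule `R` under some internal context (`→I,R`). -/
def IStepR (R : Rule) (t u : T) : Prop := ∃ C : Ctx, C.Internal ∧ StepAt R C t u

/-- Full reduction `→F` of λ!. -/
def FStep (t u : T) : Prop := ∃ R, FStepR R t u

/-- Surface reduction `→S` of λ!. -/
def SStep (t u : T) : Prop := ∃ R, SStepR R t u

/-- Internal reduction `→I` of λ!. -/
def IStep (t u : T) : Prop := ∃ R, IStepR R t u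

/-- Diligent administrative surface reduction `→Sai`: `d!`-surface steps, together with
`dB`- and `s!`-surface steps whose source is a `→S,d!`-normal form. -/
def SaiStep (t u : T) : Prop :=
  SStepR Rule.dBang t u ∨
    ((SStepR Rule.dB t u ∨ SStepR Rule.sBang t u) ∧ IsNF (SStepR Rule.dBang) t)

/-- Diligent administrative full reduction `→Fai`: `d!`-full steps, together with
`dB`- and `s!`-full steps whose source is a `→F,d!`-normal form. -/
def FaiStep (t u : T) : Prop :=
  FStepR Rule.dBang t u ∨
    ((FStepR Rule.dB t u ∨ FStepR Rule.sBang t u) ∧ IsNF (FStepR Rule.dBang) t)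

/-! ### Terms of the CBN / CBV calculi (shared syntax, de Bruijn) -/

/-- Terms of the CBN/CBV calculi: variables, application, abstraction and
explicit substitution (no `!`, no `der`). -/
inductive LT : Type
  | var : ℕ → LT
  | app : LT → LT → LT
  | lam : LT → LT
  | sub : LT → LT → LT

namespace LT

/-- Lift (shift by one) the free de Bruijn variables `≥ k`. -/
def lift (k : ℕ) : LT → LT
  | var n => if n < k then var n else var (n + 1)
  | app a b => app (lift k a) (lift k b)
  | lam a => lam (lift (k + 1) a)
  | sub a b => sub (lift (k + 1) a) (lift k b)

/-- Lift all free variables by `m`. -/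
def liftN (m : ℕ) (t : LT) : LT := (lift 0)^[m] t

/-- Lift all free variables except the first one by `m`. -/
def liftUnder (m : ℕ) (t : LT) : LT := (lift 1)^[m] t

/-- Capture-avoiding substitution `t{k := u}`. -/
def subst : LT → ℕ → LT → LT
  | var n, k, u => if n < k then var n else if n = k then liftN k u else var (n - 1)
  | app a b, k, u => app (subst a k u) (subst b k u)
  | lam a, k, u => lam (subst a (k + 1) u)
  | sub a b, k, u => sub (subst a (k + 1) u) (subst b k u)

/-- Values: variables and abstractions. -/
def IsValue : LT → Prop
  | var _ => True
  | lam _ => True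
  | _ => False

end LT

/-- Plugging a CBN/CBV term into a list context. -/
def fillLN : LT → List LT → LT
  | s, [] => s
  | s, t :: L => fillLN (LT.sub s t) L

/-- The names of the CBN rewrite rules: `dB` and `s`. -/
inductive NRule : Type
  | dB : NRule
  | s : NRule

/-- Root steps of the CBN rules:
`(dB) L⟨λx.t⟩ u ↦ L⟨t[x←u]⟩` and `(s) t[x←u] ↦ t{x:=u}`. -/
inductive NRoot : NRule → LT → LT → Prop
  | dB (t u : LT) (L : List LT) :
      NRoot NRule.dB (LT.app (fillLN (LT.lam t) L) u)
        (fillLN (LT.sub t (LT.liftN L.length u)) L)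
  | s (t u : LT) : NRoot NRule.s (LT.sub t u) (LT.subst t 0 u)

/-- The names of the CBV rewrite rules: `dB` and `sV`. -/
inductive VRule : Type
  | dB : VRule
  | sV : VRule

/-- Root steps of the CBV rules:
`(dB) L⟨λx.t⟩ u ↦ L⟨t[x←u]⟩` and `(sV) t[x←L⟨v⟩] ↦ L⟨t{x:=v}⟩` for `v` a value. -/
inductive VRoot : VRule → LT → LT → Prop
  | dB (t u : LT) (L : List LT) :
      VRoot VRule.dB (LT.app (fillLN (LT.lam t) L) u)
        (fillLN (LT.sub t (LT.liftN L.length u)) L)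
  | sV (t v : LT) (L : List LT) : v.IsValue →
      VRoot VRule.sV (LT.sub t (fillLN v L))
        (fillLN (LT.subst (LT.liftUnder L.length t) 0 v) L)

/-- (Full) contexts of the CBN/CBV calculi. -/
inductive LCtx : Type
  | hole : LCtx
  | appL : LCtx → LT → LCtx
  | appR : LT → LCtx → LCtx
  | lam : LCtx → LCtx
  | subL : LCtx → LT → LCtx
  | subR : LT → LCtx → LCtx

namespace LCtx

/-- Plugging a term in a CBN/CBV context. -/
def fill : LCtx → LT → LT
  | hole, s => s
  | appL C t, s => LT.app (fill C s) t
  | appR t C, s => LT.app t (fill C s)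
  | lam C, s => LT.lam (fill C s)
  | subL C t, s => LT.sub (fill C s) t
  | subR t C, s => LT.sub t (fill C s)

/-- CBN surface contexts: the hole never occurs in the argument of an application
or of an explicit substitution. -/
def NSurface : LCtx → Prop
  | hole => True
  | appL C _ => NSurface C
  | appR _ _ => False
  | lam C => NSurface C
  | subL C _ => NSurface C
  | subR _ _ => False

/-- CBV surface contexts: the hole never occurs under an abstraction. -/
def VSurface : LCtx → Prop
  | hole => True
  | appL C _ => VSurface C
  | appR _ C => VSurface C
  | lam _ => False
  | subL C _ => VSurface C
  | subR _ C => VSurface C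

end LCtx

/-- `NStepAt R C t u`: the CBN step firing rule `R` under context `C`. -/
def NStepAt (R : NRule) (C : LCtx) (t u : LT) : Prop :=
  ∃ a b, NRoot R a b ∧ t = C.fill a ∧ u = C.fill b

/-- `VStepAt R C t u`: the CBV step firing rule `R` under context `C`. -/
def VStepAt (R : VRule) (C : LCtx) (t u : LT) : Prop :=
  ∃ a b, VRoot R a b ∧ t = C.fill a ∧ u = C.fill b

/-- One CBN step of rule `R` under some full context. -/
def NFStepR (R : NRule) (t u : LT) : Prop := ∃ C : LCtx, NStepAt R C t u

/-- One CBN step of rule `R` under some surface context. -/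
def NSStepR (R : NRule) (t u : LT) : Prop := ∃ C : LCtx, C.NSurface ∧ NStepAt R C t u

/-- One CBN step of rule `R` under some internal context. -/
def NIStepR (R : NRule) (t u : LT) : Prop := ∃ C : LCtx, ¬ C.NSurface ∧ NStepAt R C t u

/-- CBN full reduction `→ⁿF`. -/
def NFStep (t u : LT) : Prop := ∃ R, NFStepR R t u

/-- CBN surface reduction `→ⁿS`. -/
def NSStep (t u : LT) : Prop := ∃ R, NSStepR R t u

/-- CBN internal reduction `→ⁿI`. -/
def NIStep (t u : LT) : Prop := ∃ R, NIStepR R t u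

/-- One CBV step of rule `R` under some full context. -/
def VFStepR (R : VRule) (t u : LT) : Prop := ∃ C : LCtx, VStepAt R C t u

/-- One CBV step of rule `R` under some surface context. -/
def VSStepR (R : VRule) (t u : LT) : Prop := ∃ C : LCtx, C.VSurface ∧ VStepAt R C t u

/-- One CBV step of rule `R` under some internal context. -/
def VIStepR (R : VRule) (t u : LT) : Prop := ∃ C : LCtx, ¬ C.VSurface ∧ VStepAt R C t u

/-- CBV full reduction `→ᵛF`. -/
def VFStep (t u : LT) : Prop := ∃ R, VFStepR R t u

/-- CBV surface reduction `→ᵛS`. -/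
def VSStep (t u : LT) : Prop := ∃ R, VSStepR R t u

/-- CBV internal reduction `→ᵛI`. -/
def VIStep (t u : LT) : Prop := ∃ R, VIStepR R t u

/-! ### The CBN embedding into λ! -/

/-- The CBN embedding `(·)ⁿ : xⁿ = x, (λx.t)ⁿ = λx.tⁿ, (t u)ⁿ = tⁿ !(uⁿ),
(t[x←u])ⁿ = tⁿ[x←!(uⁿ)]`. -/
def embN : LT → T
  | LT.var n => T.var n
  | LT.app t u => T.app (embN t) (T.bang (embN u))
  | LT.lam t => T.lam (embN t)
  | LT.sub t u => T.sub (embN t) (T.bang (embN u))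

/-- The CBN embedding extended to contexts, with `⟨·⟩ⁿ = ⟨·⟩`. -/
def embNC : LCtx → Ctx
  | LCtx.hole => Ctx.hole
  | LCtx.appL C t => Ctx.appL (embNC C) (T.bang (embN t))
  | LCtx.appR t C => Ctx.appR (embN t) (Ctx.bang (embNC C))
  | LCtx.lam C => Ctx.lam (embNC C)
  | LCtx.subL C t => Ctx.subL (embNC C) (T.bang (embN t))
  | LCtx.subR t C => Ctx.subR (embN t) (Ctx.bang (embNC C))

/-- The CBN embedding on rule names: `dBⁿ = dB`, `sⁿ = s!`. -/
def embNRule : NRule → Rule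
  | NRule.dB => Rule.dB
  | NRule.s => Rule.sBang

/-! ### The CBV embedding into λ! -/

/-- If `t = L⟨!s⟩` for a list context `L`, return `some L⟨s⟩`, otherwise `none`. -/
def strip? : T → Option T
  | T.bang s => some s
  | T.sub a b => (strip? a).map (fun a' => T.sub a' b)
  | _ => none

/-- The (new) CBV embedding `(·)ᵛ : xᵛ = !x, (λx.t)ᵛ = !λx.!(tᵛ),
(t u)ᵛ = der(L⟨s⟩ uᵛ)` if `tᵛ = L⟨!s⟩` and `der(der(tᵛ) uᵛ)` otherwise,
`(t[x←u])ᵛ = tᵛ[x←uᵛ]`. -/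
def embV : LT → T
  | LT.var n => T.bang (T.var n)
  | LT.lam t => T.bang (T.lam (T.bang (embV t)))
  | LT.app t u =>
      match strip? (embV t) with
      | some s => T.der (T.app s (embV u))
      | none => T.der (T.app (T.der (embV t)) (embV u))
  | LT.sub t u => T.sub (embV t) (embV u)

/-- The CBV embedding on rule names: `dBᵛ = dB`, `sVᵛ = s!`. -/
def embVRule : VRule → Rule
  | VRule.dB => Rule.dB
  | VRule.sV => Rule.sBang

theorem strip?_fillL {s s' : T} (L : List T) (h : strip? s = some s') :
    strip? (fillL s L) = some (fillL s' L) := by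
  induction L generalizing s s' with
  | nil => exact h
  | cons b L ih => exact ih (by simp [strip?, h])

theorem fillL_concat (s b : T) (L : List T) : fillL s (L ++ [b]) = T.sub (fillL s L) b := by
  induction L generalizing s with
  | nil => rfl
  | cons c L ih => exact ih _

theorem exists_fillL_of_strip? {a s : T} (h : strip? a = some s) :
    ∃ t L, a = fillL (T.bang t) L ∧ s = fillL t L := by
  induction a generalizing s with
  | bang a =>
    obtain rfl : a = s := by simpa [strip?] using h
    exact ⟨a, [], rfl, rfl⟩
  | sub a b iha =>
    simp only [strip?, Option.map_eq_some_iff] at h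
    obtain ⟨a', ha', rfl⟩ := h
    obtain ⟨t, L, rfl, rfl⟩ := iha ha'
    exact ⟨t, L ++ [b], (fillL_concat _ _ _).symm, (fillL_concat _ _ _).symm⟩
  | _ => simp [strip?] at h

/-- Inductive presentation of the administrative reduction `→F,d!`, with the root rule
expressed by `strip?`. -/
inductive AdminStep : T → T → Prop
  | root {a s : T} : strip? a = some s → AdminStep (T.der a) s
  | appL {a a' : T} (b : T) : AdminStep a a' → AdminStep (T.app a b) (T.app a' b)
  | appR (a : T) {b b' : T} : AdminStep b b' → AdminStep (T.app a b) (T.app a b')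
  | lam {a a' : T} : AdminStep a a' → AdminStep (T.lam a) (T.lam a')
  | bang {a a' : T} : AdminStep a a' → AdminStep (T.bang a) (T.bang a')
  | der {a a' : T} : AdminStep a a' → AdminStep (T.der a) (T.der a')
  | subL {a a' : T} (b : T) : AdminStep a a' → AdminStep (T.sub a b) (T.sub a' b)
  | subR (a : T) {b b' : T} : AdminStep b b' → AdminStep (T.sub a b) (T.sub a b')

theorem fStepR_dBang_iff {t u : T} : FStepR Rule.dBang t u ↔ AdminStep t u := by
  constructor
  · rintro ⟨C, _, _, hr, rfl, rfl⟩
    obtain - | - | ⟨t, L⟩ := hr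
    induction C with
    | hole => exact .root (strip?_fillL L rfl)
    | appL C b ih => exact .appL b ih
    | appR a C ih => exact .appR a ih
    | lam C ih => exact .lam ih
    | bang C ih => exact .bang ih
    | der C ih => exact .der ih
    | subL C b ih => exact .subL b ih
    | subR a C ih => exact .subR a ih
  · intro h
    induction h with
    | root h =>
      obtain ⟨t, L, rfl, rfl⟩ := exists_fillL_of_strip? h
      exact ⟨.hole, _, _, .dBang t L, rfl, rfl⟩
    | appL b _ ih =>
      obtain ⟨C, x, y, hr, rfl, rfl⟩ := ih
      exact ⟨.appL C b, x, y, hr, rfl, rfl⟩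
    | appR a _ ih =>
      obtain ⟨C, x, y, hr, rfl, rfl⟩ := ih
      exact ⟨.appR a C, x, y, hr, rfl, rfl⟩
    | lam _ ih =>
      obtain ⟨C, x, y, hr, rfl, rfl⟩ := ih
      exact ⟨.lam C, x, y, hr, rfl, rfl⟩
    | bang _ ih =>
      obtain ⟨C, x, y, hr, rfl, rfl⟩ := ih
      exact ⟨.bang C, x, y, hr, rfl, rfl⟩
    | der _ ih =>
      obtain ⟨C, x, y, hr, rfl, rfl⟩ := ih
      exact ⟨.der C, x, y, hr, rfl, rfl⟩
    | subL b _ ih =>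
      obtain ⟨C, x, y, hr, rfl, rfl⟩ := ih
      exact ⟨.subL C b, x, y, hr, rfl, rfl⟩
    | subR a _ ih =>
      obtain ⟨C, x, y, hr, rfl, rfl⟩ := ih
      exact ⟨.subR a C, x, y, hr, rfl, rfl⟩

/-- A step inside `L⟨!t⟩` yields a term of the same shape and a corresponding step
from `L⟨t⟩`. -/
theorem AdminStep.exists_strip? {a b s : T} (hab : AdminStep a b) (hs : strip? a = some s) :
    ∃ s', strip? b = some s' ∧ AdminStep s s' := by
  induction a generalizing b s with
  | bang a =>
    obtain rfl : a = s := by simpa [strip?] using hs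
    cases hab with
    | bang h => exact ⟨_, rfl, h⟩
  | sub a c iha =>
    simp only [strip?, Option.map_eq_some_iff] at hs
    obtain ⟨d, hd, rfl⟩ := hs
    cases hab with
    | subL _ h =>
      obtain ⟨d', hd', hstep⟩ := iha h hd
      exact ⟨T.sub d' c, by simp [strip?, hd'], .subL c hstep⟩
    | subR _ h => exact ⟨_, by simp [strip?, hd], .subR d h⟩
  | _ => simp [strip?] at hs

theorem AdminStep.diamond {t u₁ u₂ : T} (h₁ : AdminStep t u₁) (h₂ : AdminStep t u₂)
    (hne : u₁ ≠ u₂) : ∃ s, AdminStep u₁ s ∧ AdminStep u₂ s := by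
  induction h₁ generalizing u₂ with
  | root hs =>
    cases h₂ with
    | root hs' => exact absurd (Option.some.inj (hs.symm.trans hs')) hne
    | der h =>
      obtain ⟨s', hs', hstep⟩ := h.exists_strip? hs
      exact ⟨s', hstep, .root hs'⟩
  | appL b h ih =>
    cases h₂ with
    | appL _ h' =>
      obtain ⟨s, hs, hs'⟩ := ih h' (by rintro rfl; exact hne rfl)
      exact ⟨_, .appL b hs, .appL b hs'⟩
    | appR _ h' => exact ⟨_, .appR _ h', .appL _ h⟩
  | appR a h ih =>
    cases h₂ with
    | appL _ h' => exact ⟨_, .appL _ h', .appR _ h⟩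
    | appR _ h' =>
      obtain ⟨s, hs, hs'⟩ := ih h' (by rintro rfl; exact hne rfl)
      exact ⟨_, .appR a hs, .appR a hs'⟩
  | lam h ih =>
    cases h₂ with
    | lam h' =>
      obtain ⟨s, hs, hs'⟩ := ih h' (by rintro rfl; exact hne rfl)
      exact ⟨_, .lam hs, .lam hs'⟩
  | bang h ih =>
    cases h₂ with
    | bang h' =>
      obtain ⟨s, hs, hs'⟩ := ih h' (by rintro rfl; exact hne rfl)
      exact ⟨_, .bang hs, .bang hs'⟩
  | der h ih =>
    cases h₂ with
    | root hs =>
      obtain ⟨s', hs', hstep⟩ := h.exists_strip? hs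
      exact ⟨s', .root hs', hstep⟩
    | der h' =>
      obtain ⟨s, hs, hs'⟩ := ih h' (by rintro rfl; exact hne rfl)
      exact ⟨_, .der hs, .der hs'⟩
  | subL b h ih =>
    cases h₂ with
    | subL _ h' =>
      obtain ⟨s, hs, hs'⟩ := ih h' (by rintro rfl; exact hne rfl)
      exact ⟨_, .subL b hs, .subL b hs'⟩
    | subR _ h' => exact ⟨_, .subR _ h', .subL _ h⟩
  | subR a h ih =>
    cases h₂ with
    | subL _ h' => exact ⟨_, .subL _ h', .subR _ h⟩
    | subR _ h' =>
      obtain ⟨s, hs, hs'⟩ := ih h' (by rintro rfl; exact hne rfl)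
      exact ⟨_, .subR a hs, .subR a hs'⟩

theorem fStepR_dBang_diamond {t u₁ u₂ : T} (h₁ : FStepR Rule.dBang t u₁)
    (h₂ : FStepR Rule.dBang t u₂) (hne : u₁ ≠ u₂) :
    ∃ s, FStepR Rule.dBang u₁ s ∧ FStepR Rule.dBang u₂ s := by
  simp only [fStepR_dBang_iff] at *
  exact h₁.diamond h₂ hne

/-- **Diamond and confluence of the administrative reduction `→F,d!` of λ!.** -/
theorem admin_diamond_and_confluence :
    (∀ t u₁ u₂ : T, FStepR Rule.dBang t u₁ → FStepR Rule.dBang t u₂ → u₁ ≠ u₂ →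
      ∃ s, FStepR Rule.dBang u₁ s ∧ FStepR Rule.dBang u₂ s) ∧
    (∀ t u₁ u₂ : T, Relation.ReflTransGen (FStepR Rule.dBang) t u₁ →
      Relation.ReflTransGen (FStepR Rule.dBang) t u₂ →
      ∃ s, Relation.ReflTransGen (FStepR Rule.dBang) u₁ s ∧
        Relation.ReflTransGen (FStepR Rule.dBang) u₂ s) := by
  refine ⟨fun _ _ _ => fStepR_dBang_diamond, fun _ _ _ h₁ h₂ =>
    Relation.church_rosser (fun _ b c hb hc => ?_) h₁ h₂⟩
  by_cases hne : b = c
  · subst hne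
    exact ⟨b, .refl, .refl⟩
  · obtain ⟨s, hs, hs'⟩ := fStepR_dBang_diamond hb hc hne
    exact ⟨s, .single hs, .single hs'⟩

end BangPaper
end

section
/- (CBN one-step reverse simulation.) Let t be a CBN term, u' a λ!-term, F a λ! full context and R' ∈ {dB, s!, d!}. If tⁿ →F u' by firing rule R' under context F, then there exist a CBN term u with uⁿ = u', a CBN rule R ∈ {dB, s} with Rⁿ = R', and a CBN full context N with Nⁿ = F, such that t →ⁿF u by firing R under N. (In particular the case R' = d! never occurs, since tⁿ contains no 'der'.) -/
namespace BangPaper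

theorem embN_lift (t : LT) : ∀ k, embN (t.lift k) = (embN t).lift k := by
  induction t with
  | var n => intro k; simp only [LT.lift, embN, T.lift]; split <;> rfl
  | app a b iha ihb => intro k; simp [LT.lift, embN, T.lift, iha, ihb]
  | lam a iha => intro k; simp [LT.lift, embN, T.lift, iha]
  | sub a b iha ihb => intro k; simp [LT.lift, embN, T.lift, iha, ihb]

theorem embN_liftN (m : ℕ) (t : LT) : embN (t.liftN m) = (embN t).liftN m :=
  Function.Semiconj.iterate_right (fun s => embN_lift s 0) m t

theorem embN_subst (t u : LT) : ∀ k, embN (t.subst k u) = (embN t).subst k (embN u) := by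
  induction t with
  | var n =>
    intro k
    simp only [LT.subst, embN, T.subst]
    split
    · rfl
    · split
      · exact embN_liftN k u
      · rfl
  | app a b iha ihb => intro k; simp [LT.subst, embN, T.subst, iha, ihb]
  | lam a iha => intro k; simp [LT.subst, embN, T.subst, iha]
  | sub a b iha ihb => intro k; simp [LT.subst, embN, T.subst, iha, ihb]

theorem embN_fillLN (L : List LT) :
    ∀ s, embN (fillLN s L) = fillL (embN s) (L.map fun r => T.bang (embN r)) := by
  induction L with
  | nil => intro s; rfl
  | cons r L ih => intro s; exact ih (LT.sub s r)

theorem exists_fillLN_of_embN_eq_fillL {s : LT} (L : List T) :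
    ∀ {h : T}, embN s = fillL h L → ∃ (s' : LT) (L' : List LT),
      s = fillLN s' L' ∧ embN s' = h ∧ L'.map (fun r => T.bang (embN r)) = L := by
  induction L with
  | nil => intro h e; exact ⟨s, [], rfl, e, rfl⟩
  | cons r L ih =>
    intro h e
    obtain ⟨s', L', rfl, e', rfl⟩ := ih (h := T.sub h r) e
    cases s' <;> simp only [embN, reduceCtorEq, T.sub.injEq] at e'
    case sub a b =>
      obtain ⟨rfl, rfl⟩ := e'
      exact ⟨a, b :: L', rfl, rfl, rfl⟩

theorem eq_of_fillL_eq_bang {w : T} (L : List T) :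
    ∀ {h : T}, T.bang w = fillL h L → h = T.bang w ∧ L = [] := by
  induction L with
  | nil => intro h e; exact ⟨e.symm, rfl⟩
  | cons r L ih =>
    intro h e
    have := (ih (h := T.sub h r) e).1
    cases this

/-- Root steps out of an embedded term are embeddings of CBN root steps. -/
theorem exists_nRoot_of_root_embN {t : LT} {R' : Rule} {b : T} (h : Root R' (embN t) b) :
    ∃ (u : LT) (R : NRule), embN u = b ∧ embNRule R = R' ∧ NRoot R t u := by
  generalize ht : embN t = a at h
  cases h with
  | dB s v L =>
    cases t <;> simp only [embN, reduceCtorEq, T.app.injEq] at ht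
    case app t₁ t₂ =>
      obtain ⟨h₁, rfl⟩ := ht
      obtain ⟨s', L', rfl, hs, rfl⟩ := exists_fillLN_of_embN_eq_fillL L h₁
      cases s' <;> simp only [embN, reduceCtorEq, T.lam.injEq] at hs
      case lam s' =>
        subst hs
        refine ⟨_, NRule.dB, ?_, rfl, NRoot.dB s' t₂ L'⟩
        have hb : ∀ m, (T.bang (embN t₂)).liftN m = T.bang (embN (t₂.liftN m)) := by
          intro m
          rw [embN_liftN]
          exact (Function.Semiconj.iterate_right (f := T.bang) (ga := T.lift 0) (gb := T.lift 0)
            (fun _ => rfl) m (embN t₂)).symm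
        rw [embN_fillLN, List.length_map, hb]
        rfl
  | sBang s v L =>
    cases t <;> simp only [embN, reduceCtorEq, T.sub.injEq] at ht
    case sub t₁ t₂ =>
      obtain ⟨rfl, h₂⟩ := ht
      obtain ⟨h₃, rfl⟩ := eq_of_fillL_eq_bang L h₂
      cases h₃
      exact ⟨_, NRule.s, embN_subst t₁ t₂ 0, rfl, NRoot.s t₁ t₂⟩
  | dBang s L =>
    cases t <;> simp only [embN, reduceCtorEq] at ht

theorem embN_fill (N : LCtx) (s : LT) : embN (N.fill s) = (embNC N).fill (embN s) := by
  induction N <;> simp [LCtx.fill, embNC, Ctx.fill, embN, *]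

/-- Every decomposition of an embedded term as a context plugged with a term that is not a bang
lifts along the embedding. -/
theorem exists_fill_of_embN_eq_fill (t : LT) :
    ∀ {F : Ctx} {a : T}, (∀ w, a ≠ T.bang w) → embN t = F.fill a →
      ∃ (N : LCtx) (s : LT), embNC N = F ∧ embN s = a ∧ t = N.fill s := by
  induction t with
  | var n =>
    intro F a ha h
    cases F <;> simp only [embN, Ctx.fill, reduceCtorEq] at h
    exact ⟨LCtx.hole, _, rfl, (by simpa only [embN] using h), rfl⟩
  | lam t ih =>
    intro F a ha h
    cases F <;> simp only [embN, Ctx.fill, reduceCtorEq, T.lam.injEq] at h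
    case hole => exact ⟨LCtx.hole, _, rfl, (by simpa only [embN] using h), rfl⟩
    case lam F =>
      obtain ⟨N, s, rfl, rfl, rfl⟩ := ih ha h
      exact ⟨LCtx.lam N, s, rfl, rfl, rfl⟩
  | app t r iht ihr =>
    intro F a ha h
    cases F <;> simp only [embN, Ctx.fill, reduceCtorEq, T.app.injEq] at h
    case hole => exact ⟨LCtx.hole, _, rfl, (by simpa only [embN] using h), rfl⟩
    case appL F _ =>
      obtain ⟨h, rfl⟩ := h
      obtain ⟨N, s, rfl, rfl, rfl⟩ := iht ha h
      exact ⟨LCtx.appL N r, s, rfl, rfl, rfl⟩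
    case appR _ F =>
      obtain ⟨rfl, h⟩ := h
      cases F <;> simp only [Ctx.fill, reduceCtorEq, T.bang.injEq] at h
      case hole => exact absurd h.symm (ha _)
      case bang F =>
        obtain ⟨N, s, rfl, rfl, rfl⟩ := ihr ha h
        exact ⟨LCtx.appR t N, s, rfl, rfl, rfl⟩
  | sub t r iht ihr =>
    intro F a ha h
    cases F <;> simp only [embN, Ctx.fill, reduceCtorEq, T.sub.injEq] at h
    case hole => exact ⟨LCtx.hole, _, rfl, (by simpa only [embN] using h), rfl⟩
    case subL F _ =>
      obtain ⟨h, rfl⟩ := h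
      obtain ⟨N, s, rfl, rfl, rfl⟩ := iht ha h
      exact ⟨LCtx.subL N r, s, rfl, rfl, rfl⟩
    case subR _ F =>
      obtain ⟨rfl, h⟩ := h
      cases F <;> simp only [Ctx.fill, reduceCtorEq, T.bang.injEq] at h
      case hole => exact absurd h.symm (ha _)
      case bang F =>
        obtain ⟨N, s, rfl, rfl, rfl⟩ := ihr ha h
        exact ⟨LCtx.subR t N, s, rfl, rfl, rfl⟩

/-- **CBN one-step reverse simulation.**  If `tⁿ →F u'` by firing rule
`R' ∈ {dB, s!, d!}` under the full context `F` of λ!, then there exist a CBN term `u`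
with `uⁿ = u'`, a CBN rule `R` with `Rⁿ = R'` and a CBN full context `N` with `Nⁿ = F`
such that `t →ⁿF u` by firing `R` under `N`. -/
theorem cbn_one_step_reverse_simulation (t : LT) (u' : T) (F : Ctx) (R' : Rule)
    (h : StepAt R' F (embN t) u') :
    ∃ (u : LT) (R : NRule) (N : LCtx),
      embN u = u' ∧ embNRule R = R' ∧ embNC N = F ∧ NStepAt R N t u := by
  obtain ⟨a, b, hr, ht, rfl⟩ := h
  have ha : ∀ w, a ≠ T.bang w := by
    rintro w rfl
    cases hr
  obtain ⟨N, s, rfl, rfl, rfl⟩ := exists_fill_of_embN_eq_fill t ha ht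
  obtain ⟨v, R, rfl, rfl, hv⟩ := exists_nRoot_of_root_embN hr
  exact ⟨N.fill v, R, N, embN_fill N v, rfl, rfl, s, v, hv, rfl, rfl⟩

end BangPaper
end
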